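/- arXiv:1709.00335 — 5 statements merged into one kernel-verified Lean document; each statement's English description precedes it below -/
import Mathlib

section
/- Let a, b, c be complex numbers with Re(b) > 0, such that neither c nor 2b − c is a negative integer, and such that none of (1+c)/2, (2+c)/2, b + (1−c)/2, b + (2−c)/2 is a nonpositive integer. Then Σ_{k=0}^{∞} (a)_k (1−a)_k (1+b)_k / (k! (1+c)_k (1+2b−c)_k) = (1/b) · Γ((1+c)/2)Γ((2+c)/2)Γ(b+(1−c)/2)Γ(b+(2−c)/2) / (Γ((a+c)/2)Γ((1−a+c)/2)Γ(b+(1+a−c)/2)Γ(b+(2−a−c)/2)) + (1/b) · Γ((1+c)/2)Γ((2+c)/2)Γ(b+(1−c)/2)Γ(b+(2−c)/2) / (Γ((1+a+c)/2)Γ((2−a+c)/2)Γ(b+(a−c)/2)Γ(b+(1−a−c)/2)). -/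
open Finset Complex

/-- Shifted factorial (Pochhammer symbol) `(x)_k = x(x+1)⋯(x+k-1)`. -/
noncomputable def poch (x : ℂ) (k : ℕ) : ℂ := ∏ j ∈ Finset.range k, (x + j)

/-- The terms of the hypergeometric series `₃F₂(x, y, z; u, v; 1)`. -/
noncomputable def hypTerm (x y z u v : ℂ) (k : ℕ) : ℂ :=
  poch x k * poch y k * poch z k / ((k.factorial : ℂ) * poch u k * poch v k)

theorem poch_zero (x : ℂ) : poch x 0 = 1 := by simp [poch]

theorem poch_succ (x : ℂ) (k : ℕ) : poch x (k + 1) = poch x k * (x + k) := by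
  simp [poch, Finset.prod_range_succ]

theorem poch_add_one_mul (x : ℂ) (k : ℕ) : poch (x + 1) k * x = poch x k * (x + k) := by
  rw [← poch_succ, poch, poch, Finset.prod_range_succ']
  simp [add_assoc, add_comm (1 : ℂ)]

theorem poch_one (k : ℕ) : poch 1 k = (k.factorial : ℂ) := by
  induction k with
  | zero => simp [poch]
  | succ k ih => rw [poch_succ, ih, Nat.factorial_succ]; push_cast; ring

theorem poch_ne_zero {x : ℂ} (hx : ∀ m : ℕ, x + m ≠ 0) (k : ℕ) : poch x k ≠ 0 :=
  Finset.prod_ne_zero_iff.mpr fun j _ => hx j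

theorem Gamma_ne_zero_of_add_ne_zero {x : ℂ} (hx : ∀ m : ℕ, x + m ≠ 0) :
    Complex.Gamma x ≠ 0 :=
  Complex.Gamma_ne_zero fun m h => hx m (by rw [h]; ring)

theorem tendsto_poch_div_cpow (x : ℂ) :
    Filter.Tendsto (fun n : ℕ => poch x (n + 1) / ((n : ℂ) ^ x * (n.factorial : ℂ)))
      Filter.atTop (nhds (Complex.Gamma x)⁻¹) := by
  have key : (fun n : ℕ => poch x (n + 1) / ((n : ℂ) ^ x * (n.factorial : ℂ))) =
      fun n => (Complex.GammaSeq x n)⁻¹ := by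
    funext n
    simp [Complex.GammaSeq, poch]
  rw [key]
  by_cases h : ∀ m : ℕ, x ≠ -m
  · exact (Complex.GammaSeq_tendsto_Gamma x).inv₀ (Complex.Gamma_ne_zero h)
  · push Not at h
    obtain ⟨m, rfl⟩ := h
    rw [Complex.Gamma_neg_nat_eq_zero, inv_zero]
    refine tendsto_const_nhds.congr' ?_
    filter_upwards [Filter.eventually_ge_atTop m] with n hn
    have : ∏ j ∈ Finset.range (n + 1), (-(m : ℂ) + j) = 0 :=
      Finset.prod_eq_zero (Finset.mem_range.mpr (Nat.lt_succ_of_le hn)) (by simp)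
    simp [Complex.GammaSeq, this]

theorem tendsto_poch_mul_div_poch_mul {x y u v : ℂ} (h : x + y = u + v)
    (hu : ∀ m : ℕ, u + m ≠ 0) (hv : ∀ m : ℕ, v + m ≠ 0) :
    Filter.Tendsto (fun n : ℕ => poch x n * poch y n / (poch u n * poch v n)) Filter.atTop
      (nhds (Complex.Gamma u * Complex.Gamma v / (Complex.Gamma x * Complex.Gamma y))) := by
  rw [← Filter.tendsto_add_atTop_iff_nat 1]
  have key := ((tendsto_poch_div_cpow x).mul (tendsto_poch_div_cpow y)).div
    ((tendsto_poch_div_cpow u).mul (tendsto_poch_div_cpow v))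
    (mul_ne_zero (inv_ne_zero (Gamma_ne_zero_of_add_ne_zero hu))
      (inv_ne_zero (Gamma_ne_zero_of_add_ne_zero hv)))
  have e : Complex.Gamma u * Complex.Gamma v / (Complex.Gamma x * Complex.Gamma y) =
      (Complex.Gamma x)⁻¹ * (Complex.Gamma y)⁻¹ /
        ((Complex.Gamma u)⁻¹ * (Complex.Gamma v)⁻¹) := by
    simp only [div_eq_mul_inv, mul_inv, inv_inv]; ring
  rw [e]
  refine key.congr' ?_
  filter_upwards [Filter.eventually_gt_atTop 0] with n hn
  have hn0 : (n : ℂ) ≠ 0 := by exact_mod_cast hn.ne'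
  have hf : (n.factorial : ℂ) ≠ 0 := by exact_mod_cast n.factorial_ne_zero
  have hpow : (n : ℂ) ^ x * (n : ℂ) ^ y = (n : ℂ) ^ u * (n : ℂ) ^ v := by
    rw [← Complex.cpow_add _ _ hn0, ← Complex.cpow_add _ _ hn0, h]
  have hU := poch_ne_zero hu (n + 1)
  have hV := poch_ne_zero hv (n + 1)
  have h1 : (n : ℂ) ^ x ≠ 0 := by simp [Complex.cpow_eq_zero_iff, hn0]
  have h2 : (n : ℂ) ^ y ≠ 0 := by simp [Complex.cpow_eq_zero_iff, hn0]
  have h3 : (n : ℂ) ^ u ≠ 0 := by simp [Complex.cpow_eq_zero_iff, hn0]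
  have h4 : (n : ℂ) ^ v ≠ 0 := by simp [Complex.cpow_eq_zero_iff, hn0]
  simp only [Pi.div_apply]
  field_simp
  linear_combination (-(poch x (n + 1) * poch y (n + 1))) * hpow

theorem tendsto_hypTerm_mul_cpow (x y z : ℂ) {u v : ℂ}
    (hu : ∀ m : ℕ, u + m ≠ 0) (hv : ∀ m : ℕ, v + m ≠ 0) :
    ∃ l : ℂ, Filter.Tendsto
      (fun n : ℕ => hypTerm x y z u v (n + 1) * (n : ℂ) ^ (u + v + 1 - x - y - z))
      Filter.atTop (nhds l) := by
  have h1 : ∀ m : ℕ, (1 : ℂ) + m ≠ 0 := fun m => by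
    rw [add_comm]; exact_mod_cast m.succ_ne_zero
  refine ⟨_, ((((tendsto_poch_div_cpow x).mul (tendsto_poch_div_cpow y)).mul
    (tendsto_poch_div_cpow z)).div
    (((tendsto_poch_div_cpow 1).mul (tendsto_poch_div_cpow u)).mul (tendsto_poch_div_cpow v))
    (mul_ne_zero (mul_ne_zero (inv_ne_zero (Gamma_ne_zero_of_add_ne_zero h1))
      (inv_ne_zero (Gamma_ne_zero_of_add_ne_zero hu)))
      (inv_ne_zero (Gamma_ne_zero_of_add_ne_zero hv)))).congr' ?_⟩
  filter_upwards [Filter.eventually_gt_atTop 0] with n hn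
  have hn0 : (n : ℂ) ≠ 0 := by exact_mod_cast hn.ne'
  have hf : (n.factorial : ℂ) ≠ 0 := by exact_mod_cast n.factorial_ne_zero
  have hU := poch_ne_zero hu (n + 1)
  have hV := poch_ne_zero hv (n + 1)
  have hO := poch_ne_zero h1 (n + 1)
  have hp : ∀ s : ℂ, (n : ℂ) ^ s ≠ 0 := fun s => by simp [Complex.cpow_eq_zero_iff, hn0]
  have := hp x
  have := hp y
  have := hp z
  have := hp u
  have := hp v
  rw [hypTerm, ← poch_one, Complex.cpow_sub _ _ hn0, Complex.cpow_sub _ _ hn0,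
    Complex.cpow_sub _ _ hn0, Complex.cpow_add _ _ hn0, Complex.cpow_add _ _ hn0]
  simp only [Pi.div_apply, Complex.cpow_one]
  field_simp

theorem summable_norm_hypTerm {x y z u v : ℂ} (hu : ∀ m : ℕ, u + m ≠ 0)
    (hv : ∀ m : ℕ, v + m ≠ 0) (hs : 0 < (u + v - x - y - z).re) :
    Summable fun k => ‖hypTerm x y z u v k‖ := by
  obtain ⟨l, hl⟩ := tendsto_hypTerm_mul_cpow x y z hu hv
  rw [← summable_nat_add_iff 1]
  have hO := hl.isBigO_one ℝ
  have hsum : Summable fun n : ℕ => (n : ℝ) ^ (-(u + v + 1 - x - y - z).re) := by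
    rw [Real.summable_nat_rpow]
    simp at hs ⊢
    linarith
  refine summable_of_isBigO_nat hsum ?_
  rw [Asymptotics.isBigO_norm_left]
  obtain ⟨C, hC⟩ := hO.bound
  refine Asymptotics.IsBigO.of_bound C ?_
  filter_upwards [hC, Filter.eventually_gt_atTop 0] with n h hn
  have hn0 : (0 : ℝ) < n := by exact_mod_cast hn
  have hnorm : ‖(n : ℂ) ^ (u + v + 1 - x - y - z)‖ = (n : ℝ) ^ (u + v + 1 - x - y - z).re := by
    exact_mod_cast Complex.norm_cpow_eq_rpow_re_of_pos hn0 _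
  rw [norm_mul, hnorm, norm_one, mul_one] at h
  rw [Real.norm_of_nonneg (Real.rpow_nonneg hn0.le _), Real.rpow_neg hn0.le,
    ← div_eq_mul_inv, le_div_iff₀ (Real.rpow_pos_of_pos hn0 _)]
  exact h

theorem hypTerm_succ {u v : ℂ} (x y z : ℂ) (k : ℕ) :
    hypTerm x y z u v (k + 1) = hypTerm x y z u v k *
      ((x + k) * (y + k) * (z + k) / ((k + 1) * (u + k) * (v + k))) := by
  simp only [hypTerm, poch_succ, Nat.factorial_succ]
  push_cast
  rw [div_mul_div_comm]
  congr 1 <;> ring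

theorem hypTerm_shift (x y : ℂ) {z u v : ℂ} (hz : z ≠ 0) (hu : ∀ m : ℕ, u + m ≠ 0) (k : ℕ) :
    hypTerm x y (z + 1) (u + 1) v k = hypTerm x y z u v k * ((z + k) * u / (z * (u + k))) := by
  have hu0 : u ≠ 0 := by simpa using hu 0
  have h1 : poch (z + 1) k = poch z k * (z + k) / z := by
    rw [← poch_add_one_mul]; field_simp
  have h2 : poch (u + 1) k = poch u k * (u + k) / u := by
    rw [← poch_add_one_mul]; field_simp
  have := hu k
  simp only [hypTerm, h1, h2]
  have := poch_ne_zero hu k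
  by_cases hv : poch v k = 0
  · simp [hv]
  have hf : (k.factorial : ℂ) ≠ 0 := by exact_mod_cast k.factorial_ne_zero
  field_simp

theorem sum_range_mul_hypTerm {a b c g : ℂ} (hb : b ≠ 0) (hg : g = 1 + 2 * b - c)
    (hc : ∀ m : ℕ, 1 + c + m ≠ 0) (hg' : ∀ m : ℕ, g + m ≠ 0) (n : ℕ) :
    ∑ k ∈ Finset.range n, (c + k) * hypTerm a (1 - a) b (1 + c) g k =
      (a + c) * (1 - a + c) / (1 + c) *
        ∑ k ∈ Finset.range n, hypTerm a (1 - a) (b + 1) (1 + c + 1) g k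
      - n * (g + n - 1) / b * hypTerm a (1 - a) b (1 + c) g n := by
  induction n with
  | zero => simp
  | succ n ih =>
    rw [Finset.sum_range_succ, Finset.sum_range_succ, ih, hypTerm_succ,
      hypTerm_shift _ _ hb hc]
    have h0 : 1 + c ≠ 0 := by simpa using hc 0
    have h1 := hc n
    have h2 := hg' n
    have h3 : (n : ℂ) + 1 ≠ 0 := by exact_mod_cast n.succ_ne_zero
    push_cast
    generalize hypTerm a (1 - a) b (1 + c) g n = t
    generalize ∑ k ∈ Finset.range n, hypTerm a (1 - a) (b + 1) (1 + c + 1) g k = s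
    have h4 : g + (n + 1) - 1 = g + n := by ring
    rw [h4]
    field_simp
    subst hg
    ring

theorem tendsto_sum_range_mul_hypTerm {a b c g : ℂ} (hb : 0 < b.re) (hg : g = 1 + 2 * b - c)
    (hc : ∀ m : ℕ, 1 + c + m ≠ 0) (hg' : ∀ m : ℕ, g + m ≠ 0) :
    Filter.Tendsto
      (fun n => ∑ k ∈ Finset.range n, (c + k) * hypTerm a (1 - a) b (1 + c) g k) Filter.atTop
      (nhds ((a + c) * (1 - a + c) / (1 + c) *
        ∑' k, hypTerm a (1 - a) (b + 1) (1 + c + 1) g k)) := by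
  have hb0 : b ≠ 0 := by rintro rfl; simp at hb
  have hc' : ∀ m : ℕ, 1 + c + 1 + m ≠ 0 := fun m => by
    have := hc (m + 1); push_cast at this; convert this using 1; ring
  have hsum : Summable fun k => hypTerm a (1 - a) (b + 1) (1 + c + 1) g k := by
    refine (summable_norm_hypTerm hc' hg' ?_).of_norm
    have : 1 + c + 1 + g - a - (1 - a) - (b + 1) = b + 1 := by rw [hg]; ring
    rw [this]; simp; linarith
  simp only [sum_range_mul_hypTerm hb0 hg hc hg']
  have hG : Filter.Tendsto
      (fun n : ℕ => n * (g + n - 1) / b * hypTerm a (1 - a) b (1 + c) g n)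
      Filter.atTop (nhds 0) := by
    rw [← Filter.tendsto_add_atTop_iff_nat 1]
    obtain ⟨l, hl⟩ := tendsto_hypTerm_mul_cpow a (1 - a) b hc hg'
    have hexp : 1 + c + g + 1 - a - (1 - a) - b = b + 2 := by rw [hg]; ring
    rw [hexp] at hl
    have hinv : Filter.Tendsto (fun n : ℕ => ((n : ℂ))⁻¹) Filter.atTop (nhds 0) :=
      tendsto_inv_atTop_nhds_zero_nat (𝕜 := ℂ)
    have hpow : Filter.Tendsto (fun n : ℕ => (n : ℂ) ^ (-b)) Filter.atTop (nhds 0) := by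
      rw [tendsto_zero_iff_norm_tendsto_zero]
      refine ((tendsto_rpow_neg_atTop hb).comp tendsto_natCast_atTop_atTop).congr' ?_
      filter_upwards [Filter.eventually_gt_atTop 0] with n hn
      have hn0 : (0 : ℝ) < n := by exact_mod_cast hn
      have := Complex.norm_cpow_eq_rpow_re_of_pos hn0 (-b)
      simpa using this.symm
    have key := ((((hinv.const_mul 1).const_add 1).mul
      ((hinv.const_mul g).const_add 1)).mul (hpow.mul hl)).const_mul b⁻¹
    simp only [zero_mul, mul_zero] at key
    refine key.congr' ?_
    filter_upwards [Filter.eventually_gt_atTop 0] with n hn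
    have hn0 : (n : ℂ) ≠ 0 := by exact_mod_cast hn.ne'
    have hp : (n : ℂ) ^ b ≠ 0 := by simp [Complex.cpow_eq_zero_iff, hn0]
    rw [Complex.cpow_add _ _ hn0, Complex.cpow_neg, Complex.cpow_ofNat]
    push_cast
    field_simp
    ring
  simpa using (hsum.hasSum.tendsto_sum_nat.const_mul
    ((a + c) * (1 - a + c) / (1 + c))).sub hG

theorem hypTerm_comm (x y z u v : ℂ) (k : ℕ) : hypTerm x y z u v k = hypTerm x y z v u k := by
  simp only [hypTerm]; ring

theorem hypTerm_eq_mul_prod (x y z u v : ℂ) (k : ℕ) :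
    hypTerm x y z u v k = poch x k * poch y k / (k.factorial : ℂ) *
      ∏ j ∈ Finset.range k, (z + j) / ((u + j) * (v + j)) := by
  rw [Finset.prod_div_distrib, Finset.prod_mul_distrib]
  simp only [hypTerm, poch, div_mul_div_comm, mul_assoc]

theorem norm_poch_le (x : ℂ) (k : ℕ) : ‖poch x k‖ ≤ ‖poch ((‖x‖ : ℝ) : ℂ) k‖ := by
  simp only [poch, norm_prod]
  refine Finset.prod_le_prod (fun _ _ => norm_nonneg _) fun j _ => ?_
  have : ((‖x‖ : ℝ) : ℂ) + j = ((‖x‖ + j : ℝ) : ℂ) := by push_cast; rfl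
  rw [this, Complex.norm_of_nonneg (by positivity)]
  simpa using norm_add_le x (j : ℂ)

theorem norm_div_shift_le (z u v : ℂ) {N n : ℕ} (hu : ‖u‖ < N) (hv : ‖v‖ < N) (hn : N ≤ n)
    (j : ℕ) :
    ‖(z + n + j) / ((u + n + j) * (v + n + j))‖ ≤
      ‖(((‖z‖ + N : ℝ) : ℂ) + j) / ((((N - ‖u‖ : ℝ) : ℂ) + j) * (((N - ‖v‖ : ℝ) : ℂ) + j))‖ := by
  have hn' : (N : ℝ) ≤ n := by exact_mod_cast hn
  have hj : (0 : ℝ) ≤ j := j.cast_nonneg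
  have low : ∀ w : ℂ, (n : ℝ) + j - ‖w‖ ≤ ‖w + n + j‖ := fun w => by
    have h := norm_sub_norm_le ((n + j : ℕ) : ℂ) (-w)
    rw [norm_neg, Complex.norm_natCast, sub_neg_eq_add] at h
    push_cast at h
    rwa [show (n : ℂ) + j + w = w + n + j by ring] at h
  have up : ‖z + n + j‖ ≤ ‖z‖ + n + j := by
    have h := norm_add_le z ((n + j : ℕ) : ℂ)
    rw [Complex.norm_natCast] at h
    push_cast at h
    rwa [← add_assoc, ← add_assoc] at h
  have cast : (((‖z‖ + N : ℝ) : ℂ) + j) /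
      ((((N - ‖u‖ : ℝ) : ℂ) + j) * (((N - ‖v‖ : ℝ) : ℂ) + j)) =
      (((‖z‖ + N + j) / ((N - ‖u‖ + j) * (N - ‖v‖ + j)) : ℝ) : ℂ) := by
    push_cast; rfl
  have pu : 0 < N - ‖u‖ + j := by linarith
  have pv : 0 < N - ‖v‖ + j := by linarith
  have pu' : 0 < n + j - ‖u‖ := by linarith
  have pv' : 0 < n + j - ‖v‖ := by linarith
  have hz := norm_nonneg z
  rw [cast, Complex.norm_of_nonneg (by positivity), norm_div, norm_mul]
  calc ‖z + n + j‖ / (‖u + n + j‖ * ‖v + n + j‖)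
      ≤ (‖z‖ + n + j) / ((n + j - ‖u‖) * (n + j - ‖v‖)) := by
        gcongr
        · exact low u
        · exact low v
    _ = (‖z‖ + n + j) / (n + j - ‖u‖) * (1 / (n + j - ‖v‖)) := by
        rw [div_mul_div_comm, mul_one]
    _ ≤ (‖z‖ + N + j) / (N - ‖u‖ + j) * (1 / (N - ‖v‖ + j)) := by
        refine mul_le_mul ?_ (one_div_le_one_div_of_le pv (by linarith)) (by positivity)
          (by positivity)
        rw [div_le_div_iff₀ pu' pu]
        nlinarith [mul_nonneg (sub_nonneg.mpr hn') (add_nonneg hz (norm_nonneg u))]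
    _ = (‖z‖ + N + j) / ((N - ‖u‖ + j) * (N - ‖v‖ + j)) := by
        rw [div_mul_div_comm, mul_one]

theorem tendsto_div_shift (z u v : ℂ) (j : ℕ) :
    Filter.Tendsto (fun n : ℕ => (z + n + j) / ((u + n + j) * (v + n + j))) Filter.atTop
      (nhds 0) := by
  have hinv : Filter.Tendsto (fun n : ℕ => ((n : ℂ))⁻¹) Filter.atTop (nhds 0) :=
    tendsto_inv_atTop_nhds_zero_nat (𝕜 := ℂ)
  have lin : ∀ w : ℂ, Filter.Tendsto (fun n : ℕ => 1 + (w + j) * (n : ℂ)⁻¹) Filter.atTop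
      (nhds 1) := fun w => by
    simpa using (hinv.const_mul (w + j)).const_add 1
  have key := hinv.mul ((lin z).div ((lin u).mul (lin v)) (by simp))
  rw [zero_mul] at key
  refine key.congr' ?_
  filter_upwards [Filter.eventually_gt_atTop 0] with n hn
  have hn0 : (n : ℂ) ≠ 0 := by exact_mod_cast hn.ne'
  have e : ∀ w : ℂ, w + n + j = n * (1 + (w + j) * (n : ℂ)⁻¹) := fun w => by
    field_simp; ring
  rw [e z, e u, e v]
  simp only [Pi.div_apply, div_eq_mul_inv, mul_inv]
  field_simp

theorem tendsto_tsum_hypTerm_shift (x y z u v : ℂ) :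
    Filter.Tendsto (fun n : ℕ => ∑' k, hypTerm x y (z + n) (u + n) (v + n) k) Filter.atTop
      (nhds 1) := by
  obtain ⟨N, hN⟩ := exists_nat_gt (‖u‖ + ‖v‖ + ‖x‖ + ‖y‖ + ‖z‖)
  have := norm_nonneg u
  have := norm_nonneg v
  have := norm_nonneg x
  have := norm_nonneg y
  have := norm_nonneg z
  have nonpole : ∀ w : ℂ, ‖w‖ < N → ∀ m : ℕ, ((N - ‖w‖ : ℝ) : ℂ) + m ≠ 0 := fun w hw m => by
    have h : ((N - ‖w‖ : ℝ) : ℂ) + m = ((N - ‖w‖ + m : ℝ) : ℂ) := by push_cast; rfl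
    rw [h, Complex.ofReal_ne_zero]
    have : (0 : ℝ) ≤ m := m.cast_nonneg
    linarith
  have hsum : Summable fun k => ‖hypTerm (‖x‖ : ℝ) (‖y‖ : ℝ) (‖z‖ + N : ℝ) (N - ‖u‖ : ℝ)
      (N - ‖v‖ : ℝ) k‖ := by
    refine summable_norm_hypTerm (nonpole u (by linarith)) (nonpole v (by linarith)) ?_
    simp only [Complex.sub_re, Complex.add_re, Complex.ofReal_re]
    linarith
  have lim : ∀ k, Filter.Tendsto (fun n : ℕ => hypTerm x y (z + n) (u + n) (v + n) k)
      Filter.atTop (nhds (if k = 0 then 1 else 0)) := fun k => by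
    simp only [hypTerm_eq_mul_prod]
    have h := (tendsto_finsetProd (Finset.range k)
      fun j _ => tendsto_div_shift z u v j).const_mul (poch x k * poch y k / (k.factorial : ℂ))
    convert h using 2
    by_cases hk : k = 0
    · subst hk; simp [poch_zero]
    · simp [hk]
  have := tendsto_tsum_of_dominated_convergence hsum lim ?_
  · simpa using this
  · filter_upwards [Filter.eventually_ge_atTop N] with n hn k
    simp only [hypTerm_eq_mul_prod, norm_mul, norm_div, norm_prod]
    gcongr ?_ * ?_ / _ * ?_
    · exact norm_poch_le x k
    · exact norm_poch_le y k
    · refine Finset.prod_le_prod (fun _ _ => by positivity) fun j _ => ?_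
      simpa only [norm_mul, norm_div] using
        norm_div_shift_le z u v (by linarith) (by linarith) hn j

theorem add_one_add_ne_zero {u : ℂ} (hu : ∀ m : ℕ, u + m ≠ 0) (m : ℕ) : u + 1 + m ≠ 0 := by
  have := hu (m + 1)
  push_cast at this
  rwa [add_assoc, add_comm 1 (m : ℂ)]

theorem tsum_hypTerm_shift_left {a b f g : ℂ} (hb : 0 < b.re) (hg : g = 1 + 2 * b - f)
    (hf' : ∀ m : ℕ, f + m ≠ 0) (hg' : ∀ m : ℕ, g + m ≠ 0) :
    ∑' k, hypTerm a (1 - a) b f g k = (a + f) * (1 - a + f) / (f * (f + 1)) *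
      ∑' k, hypTerm a (1 - a) (b + 1) (f + 2) g k := by
  have hf0 : f ≠ 0 := by simpa using hf' 0
  have hf1 : f + 1 ≠ 0 := by simpa using hf' 1
  have hsum : Summable fun k => hypTerm a (1 - a) b f g k := by
    refine (summable_norm_hypTerm hf' hg' ?_).of_norm
    rwa [show f + g - a - (1 - a) - b = b by rw [hg]; ring]
  have hlim := tendsto_sum_range_mul_hypTerm (a := a) (c := f) hb hg
    (fun m => by rw [add_comm 1 f]; exact add_one_add_ne_zero hf' m) hg'
  have hterm : ∀ k : ℕ, (f + k) * hypTerm a (1 - a) b (1 + f) g k =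
      f * hypTerm a (1 - a) b f g k := fun k => by
    have h1 : poch (f + 1) k = poch f k * (f + k) / f := by
      rw [← poch_add_one_mul]; field_simp
    have := hf' k
    have := poch_ne_zero hf' k
    have := poch_ne_zero hg' k
    have : (k.factorial : ℂ) ≠ 0 := by exact_mod_cast k.factorial_ne_zero
    simp only [hypTerm, add_comm 1 f, h1]
    field_simp
  simp only [hterm, ← Finset.mul_sum] at hlim
  have := tendsto_nhds_unique hlim (hsum.hasSum.tendsto_sum_nat.const_mul f)
  rw [show 1 + f + 1 = f + 2 by ring, add_comm 1 f] at this
  field_simp at this ⊢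
  linear_combination -this

theorem tsum_hypTerm_shift {a b f g : ℂ} (hb : 0 < b.re) (hg : g = 1 + 2 * b - f)
    (hf' : ∀ m : ℕ, f + m ≠ 0) (hg' : ∀ m : ℕ, g + m ≠ 0) :
    ∑' k, hypTerm a (1 - a) b f g k =
      (a + f) * (1 - a + f) / (f * (f + 1)) * ((a + g) * (1 - a + g) / (g * (g + 1))) *
      ∑' k, hypTerm a (1 - a) (b + 2) (f + 2) (g + 2) k := by
  have hf2 : ∀ m : ℕ, f + 2 + m ≠ 0 := fun m => by
    have := add_one_add_ne_zero (add_one_add_ne_zero hf') m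
    rwa [show f + 1 + 1 = f + 2 by ring] at this
  rw [tsum_hypTerm_shift_left hb hg hf' hg']
  simp only [hypTerm_comm _ _ _ _ g]
  rw [tsum_hypTerm_shift_left (b := b + 1) (by simp; linarith) (by rw [hg]; ring) hg' hf2]
  simp only [hypTerm_comm _ _ _ (g + 2)]
  rw [show b + 1 + 1 = b + 2 by ring, mul_assoc]

theorem tsum_hypTerm_eq_poch_mul {a b f g : ℂ} (hb : 0 < b.re) (hg : g = 1 + 2 * b - f)
    (hf' : ∀ m : ℕ, f + m ≠ 0) (hg' : ∀ m : ℕ, g + m ≠ 0) (n : ℕ) :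
    ∑' k, hypTerm a (1 - a) b f g k =
      poch ((a + f) / 2) n * poch ((1 - a + f) / 2) n / (poch (f / 2) n * poch ((f + 1) / 2) n) *
      (poch ((a + g) / 2) n * poch ((1 - a + g) / 2) n /
        (poch (g / 2) n * poch ((g + 1) / 2) n)) *
      ∑' k, hypTerm a (1 - a) (b + (2 * n : ℕ)) (f + (2 * n : ℕ)) (g + (2 * n : ℕ)) k := by
  induction n with
  | zero => simp [poch_zero]
  | succ n ih =>
    have shift : ∀ w : ℂ, (∀ m : ℕ, w + m ≠ 0) → ∀ m : ℕ, w + (2 * n : ℕ) + m ≠ 0 :=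
      fun w hw m => by
        have := hw (2 * n + m)
        rwa [Nat.cast_add, ← add_assoc] at this
    have hpos : 0 < (b + (2 * n : ℕ)).re := by
      rw [Complex.add_re, Complex.natCast_re]; positivity
    rw [ih, tsum_hypTerm_shift hpos (by rw [hg]; push_cast; ring) (shift f hf') (shift g hg')]
    have next : ∀ w : ℂ, w + (2 * n : ℕ) + 2 = w + (2 * (n + 1) : ℕ) := fun w => by
      push_cast; ring
    have half : ∀ w : ℂ, w / 2 + n = (w + (2 * n : ℕ)) / 2 := fun w => by push_cast; ring
    simp only [next, poch_succ, half]
    generalize ∑' k, hypTerm a (1 - a) (b + (2 * (n + 1) : ℕ)) (f + (2 * (n + 1) : ℕ))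
      (g + (2 * (n + 1) : ℕ)) k = S
    simp only [div_eq_mul_inv, mul_inv, inv_inv]
    ring

theorem half_add_ne_zero {f : ℂ} (hf : ∀ m : ℕ, f + m ≠ 0) (m : ℕ) : f / 2 + m ≠ 0 := by
  have := hf (2 * m)
  contrapose! this
  push_cast
  linear_combination 2 * this

/-- Whipple's summation formula. -/
theorem tsum_hypTerm_whipple {a b f g : ℂ} (hb : 0 < b.re) (hg : g = 1 + 2 * b - f)
    (hf' : ∀ m : ℕ, f + m ≠ 0) (hg' : ∀ m : ℕ, g + m ≠ 0) :
    ∑' k, hypTerm a (1 - a) b f g k =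
      Complex.Gamma (f / 2) * Complex.Gamma ((f + 1) / 2) /
        (Complex.Gamma ((a + f) / 2) * Complex.Gamma ((1 - a + f) / 2)) *
      (Complex.Gamma (g / 2) * Complex.Gamma ((g + 1) / 2) /
        (Complex.Gamma ((a + g) / 2) * Complex.Gamma ((1 - a + g) / 2))) := by
  have quot : ∀ w : ℂ, (∀ m : ℕ, w + m ≠ 0) → Filter.Tendsto
      (fun n : ℕ => poch ((a + w) / 2) n * poch ((1 - a + w) / 2) n /
        (poch (w / 2) n * poch ((w + 1) / 2) n)) Filter.atTop
      (nhds (Complex.Gamma (w / 2) * Complex.Gamma ((w + 1) / 2) /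
        (Complex.Gamma ((a + w) / 2) * Complex.Gamma ((1 - a + w) / 2)))) := fun w hw =>
    tendsto_poch_mul_div_poch_mul (by ring) (half_add_ne_zero hw)
      (half_add_ne_zero (add_one_add_ne_zero hw))
  have htwo : Filter.Tendsto (fun n : ℕ => 2 * n) Filter.atTop Filter.atTop :=
    Filter.tendsto_id.const_mul_atTop' two_pos
  have key := ((quot f hf').mul (quot g hg')).mul
    ((tendsto_tsum_hypTerm_shift a (1 - a) b f g).comp htwo)
  rw [mul_one] at key
  refine tendsto_nhds_unique (tendsto_const_nhds.congr fun n => ?_) key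
  exact tsum_hypTerm_eq_poch_mul hb hg hf' hg' n

theorem tendsto_sum_range_mul_hypTerm_Gamma {a b c g : ℂ} (hb : 0 < b.re)
    (hg : g = 1 + 2 * b - c) (hc : ∀ m : ℕ, 1 + c + m ≠ 0) (hg' : ∀ m : ℕ, g + m ≠ 0) :
    Filter.Tendsto
      (fun n => ∑ k ∈ Finset.range n, (c + k) * hypTerm a (1 - a) b (1 + c) g k) Filter.atTop
      (nhds (2 * (Complex.Gamma ((1 + c) / 2) * Complex.Gamma ((2 + c) / 2) *
        Complex.Gamma (g / 2) * Complex.Gamma ((g + 1) / 2)) /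
        (Complex.Gamma ((a + c) / 2) * Complex.Gamma ((1 - a + c) / 2) *
          Complex.Gamma ((a + g) / 2) * Complex.Gamma ((1 - a + g) / 2)))) := by
  convert tendsto_sum_range_mul_hypTerm (a := a) hb hg hc hg' using 2
  rw [tsum_hypTerm_whipple (b := b + 1) (by simp; linarith) (by rw [hg]; ring)
    (add_one_add_ne_zero hc) hg']
  have h0 : 1 + c ≠ 0 := by simpa using hc 0
  have hG : Complex.Gamma ((1 + c + 1 + 1) / 2) = (1 + c) / 2 * Complex.Gamma ((1 + c) / 2) := by
    rw [← Complex.Gamma_add_one _ (div_ne_zero h0 two_ne_zero)]; congr 1; ring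
  have hrec : ∀ s : ℂ, (Complex.Gamma s)⁻¹ = s * (Complex.Gamma (s + 1))⁻¹ := fun s =>
    Complex.one_div_Gamma_eq_self_mul_one_div_Gamma_add_one s
  have e1 : (a + (1 + c + 1)) / 2 = (a + c) / 2 + 1 := by ring
  have e2 : (1 - a + (1 + c + 1)) / 2 = (1 - a + c) / 2 + 1 := by ring
  rw [hG, e1, e2, show 1 + c + 1 = 2 + c by ring]
  simp only [div_mul_eq_div_div, div_eq_mul_inv _ (Complex.Gamma _)]
  rw [hrec ((a + c) / 2), hrec ((1 - a + c) / 2)]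
  field_simp

theorem two_mul_mul_hypTerm {b : ℂ} (x y u v : ℂ) (h : u + v = 2 * b) (k : ℕ) :
    2 * b * hypTerm x y (1 + b) (1 + u) (1 + v) k =
      (u + k) * hypTerm x y b (1 + u) (1 + v) k + (v + k) * hypTerm x y b (1 + v) (1 + u) k := by
  have hp := poch_add_one_mul b k
  rw [hypTerm_comm x y b (1 + v), ← add_mul, show u + k + (v + k) = 2 * (b + k) by
    linear_combination h]
  simp only [hypTerm, add_comm 1 b]
  rw [mul_div_assoc', mul_div_assoc']
  congr 1
  linear_combination 2 * poch x k * poch y k * hp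

theorem stmt7 (a b c : ℂ) (hb : 0 < b.re)
    (hc : ∀ m : ℤ, m < 0 → c ≠ (m : ℂ) ∧ 2 * b - c ≠ (m : ℂ))
    (hΓ : ∀ m : ℤ, m ≤ 0 →
      (1 + c) / 2 ≠ (m : ℂ) ∧ (2 + c) / 2 ≠ (m : ℂ) ∧
      b + (1 - c) / 2 ≠ (m : ℂ) ∧ b + (2 - c) / 2 ≠ (m : ℂ)) :
    ∑' k : ℕ, poch a k * poch (1 - a) k * poch (1 + b) k /
        ((k.factorial : ℂ) * poch (1 + c) k * poch (1 + 2 * b - c) k)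
    = (1 / b) *
        (Complex.Gamma ((1 + c) / 2) * Complex.Gamma ((2 + c) / 2) *
            Complex.Gamma (b + (1 - c) / 2) * Complex.Gamma (b + (2 - c) / 2)) /
        (Complex.Gamma ((a + c) / 2) * Complex.Gamma ((1 - a + c) / 2) *
            Complex.Gamma (b + (1 + a - c) / 2) * Complex.Gamma (b + (2 - a - c) / 2))
      + (1 / b) *
        (Complex.Gamma ((1 + c) / 2) * Complex.Gamma ((2 + c) / 2) *
            Complex.Gamma (b + (1 - c) / 2) * Complex.Gamma (b + (2 - c) / 2)) /
        (Complex.Gamma ((1 + a + c) / 2) * Complex.Gamma ((2 - a + c) / 2) *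
            Complex.Gamma (b + (a - c) / 2) * Complex.Gamma (b + (1 - a - c) / 2)) := by
  have hb0 : b ≠ 0 := by rintro rfl; simp at hb
  have hu : ∀ m : ℕ, 1 + c + m ≠ 0 := fun m h =>
    (hc (-(m + 1)) (by omega)).1 (by push_cast; linear_combination h)
  have hv : ∀ m : ℕ, 1 + (2 * b - c) + m ≠ 0 := fun m h =>
    (hc (-(m + 1)) (by omega)).2 (by push_cast; linear_combination h)
  have hsum : Summable fun k => hypTerm a (1 - a) (1 + b) (1 + c) (1 + (2 * b - c)) k := by
    refine (summable_norm_hypTerm hu hv ?_).of_norm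
    rwa [show 1 + c + (1 + (2 * b - c)) - a - (1 - a) - (1 + b) = b by ring]
  have lim1 := tendsto_sum_range_mul_hypTerm_Gamma (a := a) hb (by ring) hu hv
  have lim2 := tendsto_sum_range_mul_hypTerm_Gamma (a := a) hb (by ring) hv hu
  have key := tendsto_nhds_unique (hsum.hasSum.tendsto_sum_nat.const_mul (2 * b))
    ((lim1.add lim2).congr fun n => by
      rw [← Finset.sum_add_distrib, Finset.mul_sum]
      exact Finset.sum_congr rfl fun k _ =>
        (two_mul_mul_hypTerm a (1 - a) c (2 * b - c) (by ring) k).symm)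
  rw [show 1 + 2 * b - c = 1 + (2 * b - c) by ring]
  change ∑' k, hypTerm a (1 - a) (1 + b) (1 + c) (1 + (2 * b - c)) k = _
  rw [← mul_right_inj' (mul_ne_zero two_ne_zero hb0), key,
    show b + (1 - c) / 2 = (1 + (2 * b - c)) / 2 by ring,
    show b + (2 - c) / 2 = (2 + (2 * b - c)) / 2 by ring,
    show b + (1 + a - c) / 2 = (a + (1 + (2 * b - c))) / 2 by ring,
    show b + (2 - a - c) / 2 = (1 - a + (1 + (2 * b - c))) / 2 by ring,
    show b + (a - c) / 2 = (a + (2 * b - c)) / 2 by ring,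
    show b + (1 - a - c) / 2 = (1 - a + (2 * b - c)) / 2 by ring,
    show 1 + (2 * b - c) + 1 = 2 + (2 * b - c) by ring,
    show 1 + c + 1 = 2 + c by ring,
    show a + (1 + c) = 1 + a + c by ring,
    show 1 - a + (1 + c) = 2 - a + c by ring]
  field_simp
end

section
/- For every natural number n, Σ_{k=0}^{n} (−1)^k C(n,k) C(n+k,k) H_k^{⟨2⟩} equals (−1)^n (2H_n^{⟨2⟩} − H_{n/2}^{⟨2⟩}) if n is even, and (−1)^n (2H_n^{⟨2⟩} − H_{(n−1)/2}^{⟨2⟩}) if n is odd. -/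
open Finset

/-- Harmonic number `H_n = ∑_{k=1}^n 1/k`. -/
noncomputable def harm (n : ℕ) : ℝ := ∑ k ∈ Finset.range n, 1 / ((k : ℝ) + 1)

/-- Second-order harmonic number `H_n^{⟨2⟩} = ∑_{k=1}^n 1/k²`. -/
noncomputable def harm2 (n : ℕ) : ℝ := ∑ k ∈ Finset.range n, 1 / ((k : ℝ) + 1) ^ 2

theorem harm2_succ (n : ℕ) : harm2 (n + 1) = harm2 n + 1 / ((n : ℝ) + 1) ^ 2 := by
  simp [harm2, sum_range_succ]

/-- The signed coefficient `(-1)^k C(n,k) C(n+k,k)` of the shifted Legendre polynomial. -/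
noncomputable def legendreCoeff (n k : ℕ) : ℝ :=
  (-1 : ℝ) ^ k * (n.choose k : ℝ) * ((n + k).choose k : ℝ)

/-- Closed form of the partial sums of `legendreCoeff (n + 1) k + legendreCoeff n k`. -/
noncomputable def legendrePartialSum (n m : ℕ) : ℝ :=
  2 * (-1 : ℝ) ^ m * (n.choose m : ℝ) * ((n + 1 + m).choose m : ℝ)

theorem legendreCoeff_eq_zero {n k : ℕ} (h : n < k) : legendreCoeff n k = 0 := by
  simp [legendreCoeff, Nat.choose_eq_zero_of_lt h]

theorem legendrePartialSum_eq_zero {n m : ℕ} (h : n < m) : legendrePartialSum n m = 0 := by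
  simp [legendrePartialSum, Nat.choose_eq_zero_of_lt h]

theorem cast_choose_succ_right (n m : ℕ) :
    (n.choose (m + 1) : ℝ) = n.choose m * ((n : ℝ) - m) / (m + 1) := by
  rw [eq_div_iff (by positivity)]
  rcases le_or_gt m n with h | h
  · rw [← Nat.cast_sub h]
    exact_mod_cast Nat.choose_succ_right_eq n m
  · simp [Nat.choose_eq_zero_of_lt h, Nat.choose_eq_zero_of_lt (Nat.lt_succ_of_lt h)]

theorem cast_succ_choose_succ (n m : ℕ) :
    ((n + 1).choose (m + 1) : ℝ) = ((n : ℝ) + 1) * n.choose m / (m + 1) := by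
  rw [eq_div_iff (by positivity)]
  exact_mod_cast (Nat.add_one_mul_choose_eq n m).symm

theorem legendreCoeff_succ_add_legendreCoeff (n m : ℕ) :
    legendreCoeff (n + 1) (m + 1) + legendreCoeff n (m + 1)
      = -(legendrePartialSum n m * ((n : ℝ) + 1) ^ 2 / ((m : ℝ) + 1) ^ 2) := by
  have hm : (m : ℝ) + 1 ≠ 0 := by positivity
  simp only [legendreCoeff, legendrePartialSum]
  rw [show n + (m + 1) = n + 1 + m by ring, ← add_assoc (n + 1) m 1,
    cast_succ_choose_succ n m, cast_succ_choose_succ (n + 1 + m) m,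
    cast_choose_succ_right n m, cast_choose_succ_right (n + 1 + m) m]
  push_cast
  field_simp
  ring

theorem legendrePartialSum_succ (n m : ℕ) :
    legendrePartialSum n (m + 1)
      = legendrePartialSum n m * (1 - ((n : ℝ) + 1) ^ 2 / ((m : ℝ) + 1) ^ 2) := by
  have hm : (m : ℝ) + 1 ≠ 0 := by positivity
  simp only [legendrePartialSum]
  rw [← add_assoc (n + 1) m 1, cast_succ_choose_succ (n + 1 + m) m, cast_choose_succ_right n m]
  push_cast
  field_simp
  ring

theorem sum_range_legendreCoeff_mul_harm2 (n m : ℕ) :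
    ∑ k ∈ range (m + 1), (legendreCoeff (n + 1) k + legendreCoeff n k) * harm2 k
      = legendrePartialSum n m * (harm2 m + 1 / ((n : ℝ) + 1) ^ 2) - 2 / ((n : ℝ) + 1) ^ 2 := by
  induction m with
  | zero => simp [harm2, legendrePartialSum]; ring
  | succ m ih =>
    have hm : (m : ℝ) + 1 ≠ 0 := by positivity
    have hn : (n : ℝ) + 1 ≠ 0 := by positivity
    rw [sum_range_succ, ih, legendreCoeff_succ_add_legendreCoeff, legendrePartialSum_succ,
      harm2_succ]
    field_simp
    ring

theorem sum_legendreCoeff_mul_harm2_succ (n : ℕ) :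
    ∑ k ∈ range (n + 2), legendreCoeff (n + 1) k * harm2 k
      = -∑ k ∈ range (n + 1), legendreCoeff n k * harm2 k - 2 / ((n : ℝ) + 1) ^ 2 := by
  have h := sum_range_legendreCoeff_mul_harm2 n (n + 1)
  simp only [add_mul, sum_add_distrib] at h
  rw [sum_range_succ (fun k => legendreCoeff n k * harm2 k),
    legendreCoeff_eq_zero n.lt_succ_self, legendrePartialSum_eq_zero n.lt_succ_self] at h
  linarith

theorem sum_legendreCoeff_mul_harm2 (n : ℕ) :
    ∑ k ∈ range (n + 1), legendreCoeff n k * harm2 k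
      = (-1 : ℝ) ^ n * (2 * harm2 n - harm2 (n / 2)) := by
  induction n with
  | zero => simp [harm2]
  | succ n ih =>
    rw [sum_legendreCoeff_mul_harm2_succ, ih, harm2_succ n]
    obtain ⟨j, hj⟩ := Nat.even_or_odd' n
    have hpow : (-1 : ℝ) ^ (2 * j) = 1 := by simp [pow_mul]
    rcases hj with rfl | rfl
    · rw [show (2 * j + 1) / 2 = j by omega, show 2 * j / 2 = j by omega,
        pow_succ _ (2 * j), hpow]
      push_cast
      ring
    · have hj : (j : ℝ) + 1 ≠ 0 := by positivity
      rw [show (2 * j + 1 + 1) / 2 = j + 1 by omega, show (2 * j + 1) / 2 = j by omega,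
        harm2_succ j, pow_succ _ (2 * j + 1), pow_succ _ (2 * j), hpow,
        show ((2 * j + 1 : ℕ) : ℝ) + 1 = 2 * ((j : ℝ) + 1) by push_cast; ring]
      field_simp
      ring

theorem stmt10 (n : ℕ) :
    ∑ k ∈ Finset.range (n + 1),
      (-1 : ℝ) ^ k * (n.choose k : ℝ) * ((n + k).choose k : ℝ) * harm2 k
    = if n % 2 = 0 then (-1 : ℝ) ^ n * (2 * harm2 n - harm2 (n / 2))
      else (-1 : ℝ) ^ n * (2 * harm2 n - harm2 ((n - 1) / 2)) := by
  have hodd : n % 2 ≠ 0 → (n - 1) / 2 = n / 2 := by omega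
  have h := sum_legendreCoeff_mul_harm2 n
  simp only [legendreCoeff] at h
  split_ifs with hn
  · exact h
  · rw [hodd hn]
    exact h
end

section
/- Let n and p be positive integers with 0 < p ≤ n. Then Σ_{k=0}^{n} (−1)^k C(n+k,k) C(p+n, n−k) H_{p+k}^{⟨2⟩} = ((−1)^{n−p+1}/(p · C(n,p))) · (H_{n+p} − H_{n−p} − H_{(n+p)/2} + H_{(n−p)/2}) if n − p is even, and = ((−1)^{n−p+1}/(p · C(n,p))) · (H_{n+p} − H_{n−p} − H_{(n+p−1)/2} + H_{(n−p−1)/2}) if n − p is odd. -/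
open Finset

open Nat in
/-- Alternating binomial sums are iterated forward differences. -/
theorem sum_alternating_choose_mul_eq_fwdDiff (f : ℕ → ℝ) (n x : ℕ) :
    ∑ k ∈ range (n + 1), (-1 : ℝ) ^ k * (n.choose k : ℝ) * f (x + k)
      = (-1) ^ n * (fwdDiff 1)^[n] f x := by
  rw [fwdDiff_iter_eq_sum_shift, mul_sum]
  refine sum_congr rfl fun k hk => ?_
  obtain ⟨m, rfl⟩ := Nat.exists_eq_add_of_le (Nat.lt_succ_iff.mp (mem_range.mp hk))
  have h : ((-1 : ℝ) ^ m) * (-1) ^ m = 1 := by rw [← mul_pow]; norm_num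
  simp only [Nat.add_sub_cancel_left, smul_eq_mul, mul_one, zsmul_eq_mul]
  push_cast
  rw [pow_add]
  linear_combination (-(-1 : ℝ) ^ k * ((k + m).choose k : ℝ) * f (x + k)) * h

open Nat in
theorem fwdDiff_iter_factorial_ratio (n p j x : ℕ) (hpn : p ≤ n) :
    (fwdDiff 1)^[j] (fun y : ℕ => ((n + y)! : ℝ) / ((p + y)! : ℝ)) x
      = ((n - p).descFactorial j : ℝ) * ((n + x)! : ℝ) / ((p + j + x)! : ℝ) := by
  induction j generalizing x with
  | zero => simp
  | succ j ih =>
    rw [Function.iterate_succ_apply', fwdDiff, ih, ih, Nat.descFactorial_succ,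
      show n + (x + 1) = (n + x) + 1 by ring, show p + j + (x + 1) = (p + j + x) + 1 by ring,
      show p + (j + 1) + x = (p + j + x) + 1 by ring, Nat.factorial_succ, Nat.factorial_succ]
    have hf : ((p + j + x)! : ℝ) ≠ 0 := by positivity
    rcases le_or_gt j (n - p) with hj | hj
    · obtain ⟨m, rfl⟩ := Nat.exists_eq_add_of_le hpn
      rw [Nat.add_sub_cancel_left] at hj ⊢
      push_cast [Nat.cast_sub hj]
      field_simp
      ring
    · simp [Nat.descFactorial_of_lt hj]

open Nat in
theorem sum_alternating_choose_factorial_ratio_eq_zero (n p : ℕ) (hp : 0 < p) (hpn : p ≤ n) :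
    ∑ k ∈ range (n + 1), (-1 : ℝ) ^ k * (n.choose k : ℝ) * (((n + k)! : ℝ) / ((p + k)! : ℝ))
      = 0 := by
  have h := sum_alternating_choose_mul_eq_fwdDiff
    (fun y : ℕ => ((n + y)! : ℝ) / ((p + y)! : ℝ)) n 0
  rw [fwdDiff_iter_factorial_ratio n p n 0 hpn,
    Nat.descFactorial_of_lt (show n - p < n by omega)] at h
  simpa using h

open Nat in
theorem fwdDiff_iter_inv_add_one (n x : ℕ) :
    (fwdDiff 1)^[n] (fun y : ℕ => 1 / ((y : ℝ) + 1)) x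
      = (-1) ^ n * (n ! : ℝ) * (x ! : ℝ) / ((x + n + 1)! : ℝ) := by
  induction n generalizing x with
  | zero =>
    simp only [Function.iterate_zero, id_eq, add_zero, Nat.factorial_succ]
    push_cast
    field_simp
    simp
  | succ n ih =>
    rw [Function.iterate_succ_apply', fwdDiff, ih, ih,
      show x + 1 + n + 1 = (x + n + 1) + 1 by ring, show x + (n + 1) + 1 = (x + n + 1) + 1 by ring,
      Nat.factorial_succ (x + n + 1), Nat.factorial_succ x, Nat.factorial_succ n, pow_succ]
    have hf : ((x + n + 1)! : ℝ) ≠ 0 := by positivity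
    push_cast
    field_simp
    ring

theorem harm_succ (n : ℕ) : harm (n + 1) = harm n + 1 / ((n : ℝ) + 1) := by
  simp [harm, sum_range_succ]

open Nat in
theorem fwdDiff_iter_harm2 (n x : ℕ) :
    (fwdDiff 1)^[n + 1] harm2 x
      = (-1) ^ n * (n ! : ℝ) * (x ! : ℝ) / ((x + n + 1)! : ℝ) * (harm (x + n + 1) - harm x) := by
  induction n generalizing x with
  | zero =>
    simp only [zero_add, Function.iterate_one, fwdDiff, harm2_succ, add_zero, harm_succ,
      Nat.factorial_succ]
    have hf : (x ! : ℝ) ≠ 0 := by positivity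
    push_cast
    field_simp
    simp
  | succ n ih =>
    rw [Function.iterate_succ_apply', fwdDiff, ih, ih,
      show x + 1 + n + 1 = (x + n + 1) + 1 by ring, show x + (n + 1) + 1 = (x + n + 1) + 1 by ring,
      Nat.factorial_succ (x + n + 1), Nat.factorial_succ x, Nat.factorial_succ n, pow_succ,
      harm_succ (x + n + 1), harm_succ x]
    have hf : ((x + n + 1)! : ℝ) ≠ 0 := by positivity
    push_cast
    field_simp
    ring

theorem cast_choose_mul_succ (n k : ℕ) (hk : k ≤ n + 1) :
    (n.choose k : ℝ) * ((n : ℝ) + 1) = ((n + 1).choose k : ℝ) * ((n : ℝ) + 1 - k) := by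
  have h := Nat.choose_mul_succ_eq n k
  rify [hk] at h
  exact h

open Nat in
theorem sum_alternating_choose_factorial_div (p d : ℕ) :
    ∑ k ∈ range (p + d + 1), (-1 : ℝ) ^ k * ((p + d).choose k : ℝ) *
        (((p + d + k + 1)! : ℝ) / (((p + k + 1)! : ℝ) * ((p : ℝ) + k + 1)))
      = (d ! : ℝ) * ((p + d)! : ℝ) * (p ! : ℝ) / ((p + d + p + 1)! : ℝ) := by
  induction d with
  | zero =>
    have h := sum_alternating_choose_mul_eq_fwdDiff (fun y : ℕ => 1 / ((y : ℝ) + 1)) p p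
    rw [fwdDiff_iter_inv_add_one] at h
    have h1 : ((-1 : ℝ) ^ p) * (-1) ^ p = 1 := by rw [← mul_pow]; norm_num
    calc _ = _ := sum_congr rfl fun k _ => ?_
      _ = _ := h
      _ = _ := ?_
    · have hf : ((p + k + 1)! : ℝ) ≠ 0 := by positivity
      simp only [add_zero]
      push_cast
      field_simp
    · simp only [add_zero, Nat.factorial_zero]
      push_cast
      linear_combination ((p ! : ℝ) * (p ! : ℝ) / ((p + p + 1)! : ℝ)) * h1
  | succ d ih =>
    have hz := sum_alternating_choose_factorial_ratio_eq_zero (p + d + 1) (p + 1) (by omega)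
      (by omega)
    have hext : ∑ k ∈ range (p + d + 1 + 1), (-1 : ℝ) ^ k * ((p + d).choose k : ℝ) *
        (((p + d + k + 1)! : ℝ) / (((p + k + 1)! : ℝ) * ((p : ℝ) + k + 1)))
      = (d ! : ℝ) * ((p + d)! : ℝ) * (p ! : ℝ) / ((p + d + p + 1)! : ℝ) := by
      rw [sum_range_succ, ih]; simp
    have key : ((p : ℝ) + d + p + 2) * ∑ k ∈ range (p + d + 1 + 1),
          (-1 : ℝ) ^ k * ((p + d + 1).choose k : ℝ) *
          (((p + d + 1 + k + 1)! : ℝ) / (((p + k + 1)! : ℝ) * ((p : ℝ) + k + 1)))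
        - ((p : ℝ) + d + 1) * (d + 1) * ∑ k ∈ range (p + d + 1 + 1),
          (-1 : ℝ) ^ k * ((p + d).choose k : ℝ) *
          (((p + d + k + 1)! : ℝ) / (((p + k + 1)! : ℝ) * ((p : ℝ) + k + 1)))
        = (2 * ((p : ℝ) + d) + 3) * ∑ k ∈ range (p + d + 1 + 1),
          (-1 : ℝ) ^ k * ((p + d + 1).choose k : ℝ) *
            (((p + d + 1 + k)! : ℝ) / ((p + 1 + k)! : ℝ)) := by
      rw [mul_sum, mul_sum, mul_sum, ← sum_sub_distrib]
      refine sum_congr rfl fun k hk => ?_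
      have hc := cast_choose_mul_succ (p + d) k (by have := mem_range.mp hk; omega)
      rw [Nat.factorial_succ (p + d + 1 + k), show p + d + k + 1 = p + d + 1 + k by ring,
        show p + 1 + k = p + k + 1 by ring]
      have hf : ((p + k + 1)! : ℝ) ≠ 0 := by positivity
      push_cast at hc ⊢
      field_simp
      linear_combination (-((d : ℝ) + 1)) * hc
    rw [hz, hext, mul_zero] at key
    rw [show p + (d + 1) = p + d + 1 by ring]
    have hp0 : ((p : ℝ) + d + p + 2) ≠ 0 := by positivity
    apply mul_left_cancel₀ hp0
    rw [sub_eq_zero.mp key, show p + d + 1 + p + 1 = (p + d + p + 1) + 1 by ring,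
      Nat.factorial_succ (p + d + p + 1), Nat.factorial_succ (p + d), Nat.factorial_succ d]
    have hf : ((p + d + p + 1)! : ℝ) ≠ 0 := by positivity
    push_cast
    field_simp
    ring

/-- Summation by parts against `harm2`. -/
theorem sum_sub_mul_harm2 (g : ℕ → ℝ) (p m : ℕ) (h0 : g 0 = 0) :
    ∑ k ∈ range m, (g (k + 1) - g k) * harm2 (p + k)
      = g m * harm2 (p + m) - ∑ k ∈ range m, g (k + 1) / ((p : ℝ) + k + 1) ^ 2 := by
  induction m with
  | zero => simp [h0]
  | succ m ih =>
    rw [sum_range_succ, ih, sum_range_succ, ← add_assoc, harm2_succ]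
    push_cast
    ring

/-- Partial sums of the alternating harmonic series. -/
noncomputable def altHarm (n : ℕ) : ℝ := ∑ k ∈ range n, (-1 : ℝ) ^ k / ((k : ℝ) + 1)

theorem altHarm_succ (n : ℕ) : altHarm (n + 1) = altHarm n + (-1 : ℝ) ^ n / ((n : ℝ) + 1) := by
  simp [altHarm, sum_range_succ]

theorem altHarm_two_mul (m : ℕ) : altHarm (2 * m) = harm (2 * m) - harm m := by
  induction m with
  | zero => simp [altHarm, harm]
  | succ m ih =>
    rw [show 2 * (m + 1) = 2 * m + 1 + 1 by ring, altHarm_succ, altHarm_succ, ih, harm_succ,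
      harm_succ, harm_succ, pow_succ, pow_mul]
    push_cast
    norm_num
    field_simp
    ring

theorem altHarm_eq (n : ℕ) : altHarm n = harm n - harm (n / 2) := by
  obtain ⟨m, rfl | rfl⟩ := Nat.even_or_odd' n
  · rw [altHarm_two_mul, Nat.mul_div_cancel_left _ two_pos]
  · rw [altHarm_succ, altHarm_two_mul, harm_succ, pow_mul, show (2 * m + 1) / 2 = m by omega]
    norm_num
    ring

open Nat in
theorem sum_choose_factorial_recurrence (n p : ℕ) (d : ℝ) (hd : (n : ℝ) = p + d) :
    ((n : ℝ) + p + 1) * ∑ k ∈ range (n + 1 + 1), (-1 : ℝ) ^ k * ((n + 1).choose k : ℝ) *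
          (((n + 1 + k)! : ℝ) / ((p + k)! : ℝ)) * harm2 (p + k)
        + ((n : ℝ) + 1) * (d + 1) * ∑ k ∈ range (n + 1), (-1 : ℝ) ^ k * (n.choose k : ℝ) *
          (((n + k)! : ℝ) / ((p + k)! : ℝ)) * harm2 (p + k)
      = - (2 * ((n : ℝ) + 1)) * ∑ k ∈ range (n + 1), (-1 : ℝ) ^ k * (n.choose k : ℝ) *
          (((n + k + 1)! : ℝ) / (((p + k + 1)! : ℝ) * ((p : ℝ) + k + 1))) := by
  set g : ℕ → ℝ := fun k => Nat.casesOn k 0 fun j =>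
    2 * ((n : ℝ) + 1) * ((-1 : ℝ) ^ j * (n.choose j : ℝ) *
      (((n + j + 1)! : ℝ) / ((p + j)! : ℝ))) with hg
  have hg0 : g 0 = 0 := rfl
  have hsum := sum_sub_mul_harm2 g p (n + 1 + 1) hg0
  have hlast : g (n + 1 + 1) = 0 := by simp [hg]
  rw [hlast, zero_mul, zero_sub,
    sum_range_succ (fun k : ℕ => g (k + 1) / ((p : ℝ) + k + 1) ^ 2), hlast, zero_div,
    add_zero] at hsum
  have hext : ∑ k ∈ range (n + 1), (-1 : ℝ) ^ k * (n.choose k : ℝ) *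
          (((n + k)! : ℝ) / ((p + k)! : ℝ)) * harm2 (p + k)
      = ∑ k ∈ range (n + 1 + 1), (-1 : ℝ) ^ k * (n.choose k : ℝ) *
          (((n + k)! : ℝ) / ((p + k)! : ℝ)) * harm2 (p + k) := by
    rw [sum_range_succ _ (n + 1)]; simp
  rw [hext, mul_sum, mul_sum, ← sum_add_distrib, neg_mul, mul_sum]
  refine Eq.trans (sum_congr rfl fun k hk => ?_) (hsum.trans (congrArg Neg.neg
    (sum_congr rfl fun k hk => ?_)))
  · have hk' : k ≤ n + 1 := by have := mem_range.mp hk; omega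
    cases k with
    | zero =>
      rw [hg0, sub_zero]
      simp only [hg, Nat.choose_zero_right, add_zero, Nat.factorial_succ n]
      push_cast
      have hf : ((p)! : ℝ) ≠ 0 := by positivity
      field_simp
      rw [hd]
      ring
    | succ j =>
      have h1 := cast_choose_mul_succ n (j + 1) hk'
      have h2 : ((n : ℝ) + 1) * (n.choose j : ℝ)
          = ((n + 1).choose (j + 1) : ℝ) * ((j : ℝ) + 1) := by
        exact_mod_cast Nat.add_one_mul_choose_eq n j
      simp only [hg]
      rw [← add_assoc p j 1, ← add_assoc n j 1, show n + 1 + (j + 1) = (n + j + 1) + 1 by ring,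
        Nat.factorial_succ (n + j + 1), Nat.factorial_succ (p + j), pow_succ]
      have hf : ((p + j)! : ℝ) ≠ 0 := by positivity
      push_cast at h1 ⊢
      field_simp
      have hd' : d = n - p := by linarith
      subst hd'
      linear_combination harm2 (p + j + 1) *
        (((n : ℝ) + p + 2 * j + 3) * h1 + (2 * ((p : ℝ) + j + 1)) * h2)
  · simp only [hg]
    rw [Nat.factorial_succ (p + k)]
    have hf : ((p + k)! : ℝ) ≠ 0 := by positivity
    push_cast
    field_simp

open Nat in
theorem sum_choose_factorial_harm2 (q d : ℕ) :
    ∑ k ∈ range (q + 1 + d + 1), (-1 : ℝ) ^ k * ((q + 1 + d).choose k : ℝ) *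
        (((q + 1 + d + k)! : ℝ) / ((q + 1 + k)! : ℝ)) * harm2 (q + 1 + k)
      = (-1) ^ (d + 1) * ((q + 1 + d)! : ℝ) * (q ! : ℝ) * (d ! : ℝ) / ((q + 1 + d + (q + 1))! : ℝ)
        * (altHarm (q + 1 + d + (q + 1)) - altHarm d) := by
  induction d with
  | zero =>
    have h := sum_alternating_choose_mul_eq_fwdDiff harm2 (q + 1) (q + 1)
    rw [fwdDiff_iter_harm2] at h
    have h1 : ((-1 : ℝ) ^ q) * (-1) ^ q = 1 := by rw [← mul_pow]; norm_num
    have ha : altHarm (q + 1 + 0 + (q + 1)) = harm (q + 1 + q + 1) - harm (q + 1) := by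
      rw [show q + 1 + 0 + (q + 1) = 2 * (q + 1) by ring, altHarm_two_mul,
        show q + 1 + q + 1 = 2 * (q + 1) by ring]
    calc _ = _ := sum_congr rfl fun k _ => ?_
      _ = _ := h
      _ = _ := ?_
    · have hf : ((q + 1 + k)! : ℝ) ≠ 0 := by positivity
      simp only [add_zero]
      rw [div_self hf, mul_one]
    · rw [ha, show q + 1 + 0 + (q + 1) = q + 1 + q + 1 by ring]
      simp only [add_zero, Nat.factorial_zero, altHarm, range_zero, sum_empty, pow_succ]
      push_cast
      linear_combination (-((q ! : ℝ) * ((q + 1)! : ℝ) / ((q + 1 + q + 1)! : ℝ) *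
        (harm (q + 1 + q + 1) - harm (q + 1)))) * h1
  | succ d ih =>
    have hr := sum_choose_factorial_recurrence (q + 1 + d) (q + 1) d (by push_cast; ring)
    rw [ih, sum_alternating_choose_factorial_div] at hr
    rw [show q + 1 + (d + 1) = q + 1 + d + 1 by ring]
    have hp0 : (((q + 1 + d : ℕ) : ℝ) + ((q + 1 : ℕ) : ℝ) + 1) ≠ 0 := by positivity
    apply mul_left_cancel₀ hp0
    rw [eq_sub_of_add_eq hr,
      show q + 1 + d + 1 + (q + 1) = (q + 1 + d + (q + 1)) + 1 by ring, altHarm_succ, altHarm_succ,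
      Nat.factorial_succ (q + 1 + d + (q + 1)), Nat.factorial_succ (q + 1 + d),
      Nat.factorial_succ d, Nat.factorial_succ q,
      show (-1 : ℝ) ^ (q + 1 + d + (q + 1)) = (-1) ^ d by
        rw [show q + 1 + d + (q + 1) = 2 * (q + 1) + d by ring, pow_add, pow_mul]; norm_num]
    have hf : ((q + 1 + d + (q + 1))! : ℝ) ≠ 0 := by positivity
    have h1 : ((-1 : ℝ) ^ d) ^ 2 = 1 := by rw [← pow_mul, mul_comm, pow_mul]; norm_num
    rw [pow_succ _ (d + 1), pow_succ _ d]
    push_cast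
    generalize (-1 : ℝ) ^ d = e at *
    field_simp
    ring_nf
    rw [h1]
    ring

theorem stmt11 (n p : ℕ) (hp : 0 < p) (hpn : p ≤ n) :
    ∑ k ∈ Finset.range (n + 1),
      (-1 : ℝ) ^ k * ((n + k).choose k : ℝ) * ((p + n).choose (n - k) : ℝ) * harm2 (p + k)
    = if (n - p) % 2 = 0 then
        ((-1 : ℝ) ^ (n - p + 1) / ((p : ℝ) * (n.choose p : ℝ))) *
          (harm (n + p) - harm (n - p) - harm ((n + p) / 2) + harm ((n - p) / 2))
      else
        ((-1 : ℝ) ^ (n - p + 1) / ((p : ℝ) * (n.choose p : ℝ))) *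
          (harm (n + p) - harm (n - p) - harm ((n + p - 1) / 2) + harm ((n - p - 1) / 2)) := by
  have hif : ∀ c : ℝ, (if (n - p) % 2 = 0 then
        c * (harm (n + p) - harm (n - p) - harm ((n + p) / 2) + harm ((n - p) / 2))
      else
        c * (harm (n + p) - harm (n - p) - harm ((n + p - 1) / 2) + harm ((n - p - 1) / 2)))
      = c * (altHarm (n + p) - altHarm (n - p)) := by
    intro c
    rw [altHarm_eq, altHarm_eq]
    split_ifs with h
    · ring
    · rw [show (n + p - 1) / 2 = (n + p) / 2 by omega,
        show (n - p - 1) / 2 = (n - p) / 2 by omega]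
      ring
  rw [hif]
  obtain ⟨q, rfl⟩ := Nat.exists_eq_add_of_lt hp
  obtain ⟨d, rfl⟩ := Nat.exists_eq_add_of_le hpn
  simp only [zero_add, Nat.add_sub_cancel_left]
  have h := sum_choose_factorial_harm2 q d
  have hsum : ∑ k ∈ range (q + 1 + d + 1), (-1 : ℝ) ^ k * ((q + 1 + d + k).choose k : ℝ) *
        ((q + 1 + (q + 1 + d)).choose (q + 1 + d - k) : ℝ) * harm2 (q + 1 + k)
      = ((q + 1 + d + (q + 1)).factorial : ℝ) / ((q + 1 + d).factorial : ℝ) ^ 2 *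
        ∑ k ∈ range (q + 1 + d + 1), (-1 : ℝ) ^ k * ((q + 1 + d).choose k : ℝ) *
        (((q + 1 + d + k).factorial : ℝ) / ((q + 1 + k).factorial : ℝ)) * harm2 (q + 1 + k) := by
    rw [mul_sum]
    refine sum_congr rfl fun k hk => ?_
    generalize q + 1 = p at *
    obtain ⟨m, hm⟩ := Nat.exists_eq_add_of_le (Nat.lt_succ_iff.mp (mem_range.mp hk))
    rw [hm, Nat.add_sub_cancel_left, Nat.cast_choose ℝ (show k ≤ k + m + k by omega),
      Nat.cast_choose ℝ (show m ≤ p + (k + m) by omega),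
      Nat.cast_choose ℝ (show k ≤ k + m by omega), Nat.add_sub_cancel_left,
      Nat.add_sub_cancel, show p + (k + m) - m = p + k by omega, add_comm p (k + m)]
    have h1 : ((k + m).factorial : ℝ) ≠ 0 := by positivity
    have h2 : ((p + k).factorial : ℝ) ≠ 0 := by positivity
    field_simp
  rw [hsum, h, Nat.cast_choose ℝ (show q + 1 ≤ q + 1 + d by omega), Nat.add_sub_cancel_left,
    Nat.factorial_succ q]
  have h1 : ((q + 1 + d).factorial : ℝ) ≠ 0 := by positivity
  have h2 : ((q + 1 + d + (q + 1)).factorial : ℝ) ≠ 0 := by positivity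
  push_cast
  field_simp
end

section
/- For every integer n ≥ 3, Σ_{k=0}^{n} (−1)^k C(n,k) · k² · H_{n+k}^{⟨2⟩} = (n²(n+1)/((n−1)(n−2))) · (1/C(2n,n)) · (H_{n+1} − H_{2n} + (n−1)/n²). -/
open Finset

/-- Pascal's rule for alternating binomial sums. -/
theorem alternating_sum_choose_succ (n : ℕ) (f : ℕ → ℝ) :
    ∑ k ∈ range (n + 2), (-1 : ℝ) ^ k * ((n + 1).choose k : ℝ) * f k =
      ∑ k ∈ range (n + 1), (-1 : ℝ) ^ k * (n.choose k : ℝ) * f k -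
        ∑ k ∈ range (n + 1), (-1 : ℝ) ^ k * (n.choose k : ℝ) * f (k + 1) := by
  have h : ∑ k ∈ range (n + 1), (-1 : ℝ) ^ k * (n.choose k : ℝ) * f k =
      ∑ k ∈ range (n + 2), (-1 : ℝ) ^ k * (n.choose k : ℝ) * f k := by
    rw [sum_range_succ _ (n + 1)]
    simp
  rw [h, sum_range_succ', sum_range_succ' _ (n + 1), add_sub_right_comm, ← sum_sub_distrib]
  congr 1
  · refine sum_congr rfl fun k _ => ?_
    rw [Nat.choose_succ_succ]
    push_cast
    ring
  · simp

/-- Absorption of a factor `k` into an alternating binomial sum. -/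
theorem alternating_sum_choose_mul_index (n : ℕ) (f : ℕ → ℝ) :
    ∑ k ∈ range (n + 2), (-1 : ℝ) ^ k * ((n + 1).choose k : ℝ) * (k * f k) =
      -((n : ℝ) + 1) *
        ∑ k ∈ range (n + 1), (-1 : ℝ) ^ k * (n.choose k : ℝ) * f (k + 1) := by
  rw [sum_range_succ', mul_sum]
  simp only [Nat.cast_zero, zero_mul, mul_zero, add_zero]
  refine sum_congr rfl fun k _ => ?_
  have h : ((n : ℝ) + 1) * n.choose k = (n + 1).choose (k + 1) * ((k : ℝ) + 1) := by
    exact_mod_cast Nat.add_one_mul_choose_eq n k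
  push_cast
  linear_combination (-1 : ℝ) ^ k * f (k + 1) * h

/-- The iterated differences of the second-order harmonic numbers. -/
theorem alternating_sum_choose_harm2 (n m : ℕ) :
    ∑ k ∈ range (n + 2), (-1 : ℝ) ^ k * ((n + 1).choose k : ℝ) * harm2 (m + k) =
      -((n.factorial : ℝ) * m.factorial / (m + n + 1).factorial *
        (harm (m + n + 1) - harm m)) := by
  induction n generalizing m with
  | zero =>
    have h : (m.factorial : ℝ) ≠ 0 := by positivity
    simp only [sum_range_succ, sum_range_zero, add_zero, zero_add, harm_succ, harm2_succ,
      Nat.factorial_succ]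
    push_cast
    simp
    field_simp
  | succ n ih =>
    rw [alternating_sum_choose_succ, ih m]
    have e : ∀ k, harm2 (m + (k + 1)) = harm2 (m + 1 + k) := fun k => by
      rw [add_right_comm, add_assoc]
    simp only [e]
    rw [ih (m + 1), show m + 1 + n + 1 = m + n + 1 + 1 by ring,
      show m + (n + 1) + 1 = m + n + 1 + 1 by ring]
    have h : ((m + n + 1).factorial : ℝ) ≠ 0 := by positivity
    rw [harm_succ (m + n + 1), harm_succ m, Nat.factorial_succ (m + n + 1),
      Nat.factorial_succ m, Nat.factorial_succ n]
    push_cast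
    field_simp
    ring

theorem stmt16 (n : ℕ) (hn : 3 ≤ n) :
    ∑ k ∈ Finset.range (n + 1), (-1 : ℝ) ^ k * (n.choose k : ℝ) * (k : ℝ) ^ 2 * harm2 (n + k)
    = ((n : ℝ) ^ 2 * ((n : ℝ) + 1) / (((n : ℝ) - 1) * ((n : ℝ) - 2))) *
        (1 / ((2 * n).choose n : ℝ)) *
        (harm (n + 1) - harm (2 * n) + ((n : ℝ) - 1) / (n : ℝ) ^ 2) := by
  obtain ⟨p, rfl⟩ := Nat.exists_eq_add_of_le' hn
  have absorb := alternating_sum_choose_mul_index (p + 2) fun k => k * harm2 (p + 3 + k)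
  have split : ∑ k ∈ range (p + 2 + 1), (-1 : ℝ) ^ k * ((p + 2).choose k : ℝ) *
        (((k + 1 : ℕ) : ℝ) * harm2 (p + 3 + (k + 1))) =
      ∑ k ∈ range (p + 1 + 2), (-1 : ℝ) ^ k * ((p + 1 + 1).choose k : ℝ) *
          (k * harm2 (p + 4 + k)) +
        ∑ k ∈ range (p + 1 + 2), (-1 : ℝ) ^ k * ((p + 1 + 1).choose k : ℝ) *
          harm2 (p + 4 + k) := by
    rw [← sum_add_distrib]
    refine sum_congr rfl fun k _ => ?_
    rw [show p + 3 + (k + 1) = p + 4 + k by ring]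
    push_cast
    ring
  have shift : ∀ k, harm2 (p + 4 + (k + 1)) = harm2 (p + 5 + k) := fun k => by
    rw [show p + 4 + (k + 1) = p + 5 + k by ring]
  rw [split, alternating_sum_choose_mul_index (p + 1) fun k => harm2 (p + 4 + k),
    alternating_sum_choose_harm2] at absorb
  simp only [shift] at absorb
  rw [alternating_sum_choose_harm2, show p + 4 + (p + 1) + 1 = 2 * (p + 3) by ring,
    show p + 5 + p + 1 = 2 * (p + 3) by ring] at absorb
  have hC : ((2 * (p + 3)).choose (p + 3) : ℝ) =
      (2 * (p + 3)).factorial / ((p + 3).factorial * (p + 3).factorial) := by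
    rw [Nat.cast_choose ℝ (by lia), show 2 * (p + 3) - (p + 3) = p + 3 by lia]
  have hN : ((2 * (p + 3)).factorial : ℝ) ≠ 0 := by positivity
  have hp : (p.factorial : ℝ) ≠ 0 := by positivity
  have h1 : ((p + 3 : ℕ) : ℝ) - 1 = p + 2 := by push_cast; ring
  have h2 : ((p + 3 : ℕ) : ℝ) - 2 = p + 1 := by push_cast; ring
  calc _ = _ := sum_congr rfl fun k _ => by ring
    _ = _ := absorb
    _ = _ := by
      rw [hC, h1, h2, harm_succ (p + 4), show p + 3 + 1 = p + 4 by ring]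
      generalize ((2 * (p + 3)).factorial : ℝ) = N at hN ⊢
      simp only [Nat.factorial_succ]
      push_cast
      field_simp
      ring
end

section
/- For every positive integer n, Σ_{k=0}^{n} (−1)^k C(n,k) H_{n+k}² = (1/(n · C(2n,n))) · (H_n − H_{2n} − 2/n). -/
open Finset

/-- Pascal's recurrence for alternating binomial sums. -/
theorem alternating_choose_sum_succ (f : ℕ → ℝ) (n m : ℕ) :
    ∑ k ∈ Finset.range (n + 2), (-1 : ℝ) ^ k * ((n + 1).choose k : ℝ) * f (m + k)
    = ∑ k ∈ Finset.range (n + 1), (-1 : ℝ) ^ k * (n.choose k : ℝ) * f (m + k)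
      - ∑ k ∈ Finset.range (n + 1), (-1 : ℝ) ^ k * (n.choose k : ℝ) * f (m + 1 + k) := by
  have h := Finset.sum_choose_succ_mul (fun i _ => (-1 : ℝ) ^ i * f (m + i)) n
  have comm (a b c : ℝ) : a * b * c = b * (a * c) := by ring
  simp only [comm]
  rw [h, sub_eq_add_neg, ← Finset.sum_neg_distrib]
  congr 1
  refine Finset.sum_congr rfl fun k _ => ?_
  rw [show m + 1 + k = m + (k + 1) by ring]
  ring

/-- Iterated differences of the squared harmonic numbers, at an arbitrary base point `m`. -/
theorem alternating_choose_sum_harm_sq (n m : ℕ) :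
    ∑ k ∈ Finset.range (n + 2), (-1 : ℝ) ^ k * ((n + 1).choose k : ℝ) * harm (m + k) ^ 2
    = -((n.factorial : ℝ) * m.factorial / (n + m + 1).factorial)
      * (harm (n + m + 1) + harm m - 2 * harm n) := by
  induction n generalizing m with
  | zero =>
    have hm : (m.factorial : ℝ) ≠ 0 := by positivity
    have hm' : (m : ℝ) + 1 ≠ 0 := by positivity
    simp only [Finset.sum_range_succ, Finset.sum_range_zero, zero_add, Nat.factorial_succ,
      harm_succ]
    simp [harm]
    field_simp
    ring
  | succ n ih =>
    rw [alternating_choose_sum_succ (fun k => harm k ^ 2), ih, ih,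
      show n + (m + 1) + 1 = n + m + 1 + 1 by ring, show n + 1 + m + 1 = n + m + 1 + 1 by ring]
    have hf : ((n + m + 1).factorial : ℝ) ≠ 0 := by positivity
    have hm : (m : ℝ) + 1 ≠ 0 := by positivity
    have hn : (n : ℝ) + 1 ≠ 0 := by positivity
    have hnm : (n : ℝ) + m + 1 + 1 ≠ 0 := by positivity
    rw [Nat.factorial_succ (n + m + 1), Nat.factorial_succ n, Nat.factorial_succ m,
      harm_succ (n + m + 1), harm_succ n, harm_succ m]
    push_cast
    field_simp
    ring

theorem stmt18 (n : ℕ) (hn : 0 < n) :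
    ∑ k ∈ Finset.range (n + 1), (-1 : ℝ) ^ k * (n.choose k : ℝ) * (harm (n + k)) ^ 2
    = (1 / ((n : ℝ) * ((2 * n).choose n : ℝ))) * (harm n - harm (2 * n) - 2 / (n : ℝ)) := by
  obtain ⟨p, rfl⟩ := Nat.exists_eq_succ_of_ne_zero hn.ne'
  rw [Nat.succ_eq_add_one, alternating_choose_sum_harm_sq,
    show p + (p + 1) + 1 = 2 * (p + 1) by ring]
  have hc : (((2 * (p + 1)).choose (p + 1) : ℕ) : ℝ)
      = (2 * (p + 1)).factorial / ((p + 1).factorial * (p + 1).factorial) := by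
    rw [Nat.cast_choose ℝ (by lia), show 2 * (p + 1) - (p + 1) = p + 1 by lia]
  have hf : ((2 * (p + 1)).factorial : ℝ) ≠ 0 := by positivity
  have hp : (p.factorial : ℝ) ≠ 0 := by positivity
  have hp' : (p : ℝ) + 1 ≠ 0 := by positivity
  rw [hc, harm_succ p, Nat.factorial_succ p]
  push_cast
  field_simp
  ring
end
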